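/- Let k be a field and V a k-vector space. Then V is finite-dimensional if and only if the canonical linear map dualDistrib : V* ⊗_k V* → (V ⊗_k V)*, determined by (f ⊗ g) ↦ (x ⊗ y ↦ f(x)·g(y)), is bijective. -/

import Mathlib

open TensorProduct

universe u v

lemma exists_fg_range_aux
    (k : Type u) [Field k] (V : Type v) [AddCommGroup V] [Module k V]
    (t : Module.Dual k V ⊗[k] Module.Dual k V) :
    ∃ W : Submodule k (Module.Dual k V), W.FG ∧
      ∀ x : V, TensorProduct.curry (TensorProduct.dualDistrib k V V t) x ∈ W := by
  induction t using TensorProduct.induction_on with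
  | zero => exact ⟨⊥, Submodule.fg_bot, fun x => by
      rw [Submodule.mem_bot]
      ext y
      simp⟩
  | tmul f g =>
    refine ⟨k ∙ g, Submodule.fg_span_singleton g, fun x => ?_⟩
    refine Submodule.mem_span_singleton.2 ⟨f x, ?_⟩
    ext y
    simp
  | add a b ha hb =>
    obtain ⟨W, hW, h⟩ := ha
    obtain ⟨W', hW', h'⟩ := hb
    refine ⟨W ⊔ W', hW.sup hW', fun x => ?_⟩
    have e : TensorProduct.curry (TensorProduct.dualDistrib k V V (a + b)) x =
        TensorProduct.curry (TensorProduct.dualDistrib k V V a) x +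
        TensorProduct.curry (TensorProduct.dualDistrib k V V b) x := by
      ext y
      simp
    rw [e]
    exact Submodule.add_mem_sup (h x) (h' x)

/-- A vector space `V` over a field `k` is finite-dimensional if and only if the canonical
map `dualDistrib : V* ⊗ V* → (V ⊗ V)*` is bijective. -/
theorem finiteDimensional_iff_dualDistrib_bijective
    (k : Type u) [Field k] (V : Type v) [AddCommGroup V] [Module k V] :
    FiniteDimensional k V ↔ Function.Bijective ⇑(TensorProduct.dualDistrib k V V) := by
  classical
  constructor
  · intro h
    exact (TensorProduct.dualDistribEquiv k V V).bijective
  · intro h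
    let b := Module.Free.chooseBasis k V
    obtain ⟨t, ht⟩ := h.2 (TensorProduct.lift b.toDual)
    obtain ⟨W, hW, hx⟩ := exists_fg_range_aux k V t
    have hx' : ∀ x, b.toDual x ∈ W := fun x => by
      have := hx x
      rw [ht] at this
      convert this using 1
      ext y
      simp
    have : Module.Finite k W := Module.Finite.iff_fg.2 hW
    have : IsNoetherian k W := isNoetherian_of_isNoetherianRing_of_finite k W
    refine Module.Finite.of_injective (b.toDual.codRestrict W hx') ?_
    intro x y hxy
    exact b.toDual_injective (congrArg Subtype.val hxy)
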